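/- Define f(t) = (t³ + at + b)² − 4e(ct + d) with e ≠ 0. The discriminant of the degree-six polynomial f equals e³ times the explicit polynomial 16a⁷c²d − 16a⁶bc³ + 16a⁵c⁴e + 16a⁶d³ + 216a⁴b²c²d + 888a⁴c²d²e − 216a³b³c³ − 3420a³bc³de + 2700a²b²c⁴e + 4125a²c⁴de² − 5625abc⁵e² + 3125c⁶e³ + 216a³b²d³ + 864a³d⁴e − 2592a²bcd³e + 729ab⁴c²d − 5670ab²c²d²e + 16200ac²d³e² − 729b⁵c³ + 6075b³c³de − 13500bc³d²e² + 729b⁴d³ − 5832b²d⁴e + 11664d⁵e², up to a fixed nonzero rational constant. -/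

import Mathlib

open Finset Matrix Polynomial in
/-- In the basis `1, t, t², g, gt, gt²` with `g = t³ + at + b`, which is unitriangular over the
monomials, the product of the squared differences is a Gram determinant. -/
theorem prod_sq_sub_eq_det_gram (a b : ℂ) (x : Fin 6 → ℂ) :
    (∏ i : Fin 6, ∏ j ∈ univ.filter (fun j => i < j), (x i - x j)^2) =
      (Matrix.of fun j k : Fin 6 => ∑ i,
        ![1, x i, x i ^ 2, x i ^ 3 + a * x i + b, (x i ^ 3 + a * x i + b) * x i,
          (x i ^ 3 + a * x i + b) * x i ^ 2] j *
        ![1, x i, x i ^ 2, x i ^ 3 + a * x i + b, (x i ^ 3 + a * x i + b) * x i,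
          (x i ^ 3 + a * x i + b) * x i ^ 2] k).det := by
  let p : Fin 6 → ℂ[X] := ![1, X, X ^ 2, X ^ 3 + C a * X + C b, (X ^ 3 + C a * X + C b) * X,
    (X ^ 3 + C a * X + C b) * X ^ 2]
  have cubic_monic : (X ^ 3 + C a * X + C b : ℂ[X]).Monic := by monicity!
  have cubic_deg : (X ^ 3 + C a * X + C b : ℂ[X]).natDegree = 3 := by compute_degree!
  have p_deg : ∀ i, (p i).natDegree = i := by
    intro i
    fin_cases i
    · simp [p]
    · simp [p]
    · simp [p]
    · simpa [p] using cubic_deg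
    · simpa [p, cubic_deg] using cubic_monic.natDegree_mul (monic_X (R := ℂ))
    · simpa [p, cubic_deg] using cubic_monic.natDegree_mul (monic_X_pow (R := ℂ) 2)
  have p_monic : ∀ i, (p i).Monic := by
    intro i
    fin_cases i
    · exact monic_one
    · exact monic_X
    · exact monic_X_pow 2
    · exact cubic_monic
    · exact cubic_monic.mul monic_X
    · exact cubic_monic.mul (monic_X_pow 2)
  have vandermonde_sq : (∏ i : Fin 6, ∏ j ∈ univ.filter (fun j => i < j), (x i - x j)^2) =
      (vandermonde x).det ^ 2 := by
    rw [det_vandermonde, ← prod_pow]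
    refine prod_congr rfl fun i _ => ?_
    rw [← prod_pow, filter_lt_eq_Ioi]
    exact prod_congr rfl fun j _ => by ring
  rw [vandermonde_sq, det_eval_matrixOfPolynomials_eq_det_vandermonde x p p_deg p_monic, sq]
  nth_rewrite 1 [← det_transpose]
  rw [← det_mul]
  congr 1
  ext j k
  simp only [mul_apply, transpose_apply, of_apply]
  refine sum_congr rfl fun i _ => ?_
  congr 1
  · fin_cases j <;> simp [p]
  · fin_cases k <;> simp [p]

/-- A polynomial of degree at most five that vanishes identically has zero nonconstant coefficients. -/
theorem coeffs_eq_zero_of_quintic (r₅ r₄ r₃ r₂ r₁ r₀ : ℂ)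
    (h : ∀ t : ℂ, r₅ * t ^ 5 + r₄ * t ^ 4 + r₃ * t ^ 3 + r₂ * t ^ 2 + r₁ * t + r₀ = 0) :
    r₅ = 0 ∧ r₄ = 0 ∧ r₃ = 0 ∧ r₂ = 0 ∧ r₁ = 0 := by
  refine ⟨?_, ?_, ?_, ?_, ?_⟩
  · linear_combination (-1/12) * h 0 + (1/12) * h 1 + (1/24) * h (-1) + (-1/24) * h 2 +
      (-1/120) * h (-2) + (1/120) * h 3
  · linear_combination (1/4) * h 0 + (-1/6) * h 1 + (-1/6) * h (-1) + (1/24) * h 2 +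
      (1/24) * h (-2)
  · linear_combination (5/12) * h 0 + (-7/12) * h 1 + (-1/24) * h (-1) + (7/24) * h 2 +
      (-1/24) * h (-2) + (-1/24) * h 3
  · linear_combination (-5/4) * h 0 + (2/3) * h 1 + (2/3) * h (-1) + (-1/24) * h 2 +
      (-1/24) * h (-2)
  · linear_combination (-1/3) * h 0 + h 1 + (-1/2) * h (-1) + (-1/4) * h 2 +
      (1/20) * h (-2) + (1/30) * h 3

/-- The first five power sums of the roots of a monic sextic without `t⁵` term. -/
theorem power_sums_of_sextic (u₄ u₃ u₂ u₁ u₀ : ℂ) (x : Fin 6 → ℂ)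
    (h : ∀ t : ℂ, t ^ 6 + u₄ * t ^ 4 + u₃ * t ^ 3 + u₂ * t ^ 2 + u₁ * t + u₀ = ∏ i, (t - x i)) :
    ∑ i, x i = 0 ∧ ∑ i, x i ^ 2 = -2 * u₄ ∧ ∑ i, x i ^ 3 = -3 * u₃ ∧
      ∑ i, x i ^ 4 = 2 * u₄ ^ 2 - 4 * u₂ ∧ ∑ i, x i ^ 5 = 5 * u₄ * u₃ - 5 * u₁ := by
  simp only [Fin.prod_univ_six] at h
  simp only [Fin.sum_univ_six]
  generalize x 0 = x₀ at *
  generalize x 1 = x₁ at *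
  generalize x 2 = x₂ at *
  generalize x 3 = x₃ at *
  generalize x 4 = x₄ at *
  generalize x 5 = x₅ at *
  obtain ⟨e1, he1⟩ : ∃ s, s =
      x₀ + x₁ + x₂ + x₃ + x₄ + x₅ := ⟨_, rfl⟩
  obtain ⟨e2, he2⟩ : ∃ s, s =
      x₀*x₁ + x₀*x₂ + x₀*x₃ + x₀*x₄ + x₀*x₅ + x₁*x₂ + x₁*x₃ + x₁*x₄ + x₁*x₅ + x₂*x₃ + x₂*x₄ +
      x₂*x₅ + x₃*x₄ + x₃*x₅ + x₄*x₅ := ⟨_, rfl⟩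
  obtain ⟨e3, he3⟩ : ∃ s, s =
      x₀*x₁*x₂ + x₀*x₁*x₃ + x₀*x₁*x₄ + x₀*x₁*x₅ + x₀*x₂*x₃ + x₀*x₂*x₄ + x₀*x₂*x₅ + x₀*x₃*x₄ +
      x₀*x₃*x₅ + x₀*x₄*x₅ + x₁*x₂*x₃ + x₁*x₂*x₄ + x₁*x₂*x₅ + x₁*x₃*x₄ + x₁*x₃*x₅ + x₁*x₄*x₅ +
      x₂*x₃*x₄ + x₂*x₃*x₅ + x₂*x₄*x₅ + x₃*x₄*x₅ := ⟨_, rfl⟩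
  obtain ⟨e4, he4⟩ : ∃ s, s =
      x₀*x₁*x₂*x₃ + x₀*x₁*x₂*x₄ + x₀*x₁*x₂*x₅ + x₀*x₁*x₃*x₄ + x₀*x₁*x₃*x₅ + x₀*x₁*x₄*x₅ +
      x₀*x₂*x₃*x₄ + x₀*x₂*x₃*x₅ + x₀*x₂*x₄*x₅ + x₀*x₃*x₄*x₅ + x₁*x₂*x₃*x₄ + x₁*x₂*x₃*x₅ +
      x₁*x₂*x₄*x₅ + x₁*x₃*x₄*x₅ + x₂*x₃*x₄*x₅ := ⟨_, rfl⟩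
  obtain ⟨e5, he5⟩ : ∃ s, s =
      x₀*x₁*x₂*x₃*x₄ + x₀*x₁*x₂*x₃*x₅ + x₀*x₁*x₂*x₄*x₅ + x₀*x₁*x₃*x₄*x₅ + x₀*x₂*x₃*x₄*x₅ +
      x₁*x₂*x₃*x₄*x₅ := ⟨_, rfl⟩
  obtain ⟨e6, he6⟩ : ∃ s, s =
      x₀*x₁*x₂*x₃*x₄*x₅ := ⟨_, rfl⟩
  have p1 : x₀ + x₁ + x₂ + x₃ + x₄ + x₅ = e1 := he1.symm
  have p2 : x₀ ^ 2 + x₁ ^ 2 + x₂ ^ 2 + x₃ ^ 2 + x₄ ^ 2 + x₅ ^ 2 =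
      e1 ^ 2 - 2 * e2 := by
    subst he1 he2; ring
  have p3 : x₀ ^ 3 + x₁ ^ 3 + x₂ ^ 3 + x₃ ^ 3 + x₄ ^ 3 + x₅ ^ 3 =
      e1 ^ 3 - 3 * e1 * e2 + 3 * e3 := by
    subst he1 he2 he3; ring
  have p4 : x₀ ^ 4 + x₁ ^ 4 + x₂ ^ 4 + x₃ ^ 4 + x₄ ^ 4 + x₅ ^ 4 =
      e1 ^ 4 - 4 * e1 ^ 2 * e2 + 2 * e2 ^ 2 + 4 * e1 * e3 - 4 * e4 := by
    subst he1 he2 he3 he4; ring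
  have p5 : x₀ ^ 5 + x₁ ^ 5 + x₂ ^ 5 + x₃ ^ 5 + x₄ ^ 5 + x₅ ^ 5 =
      e1 ^ 5 - 5 * e1 ^ 3 * e2 + 5 * e1 * e2 ^ 2 + 5 * e1 ^ 2 * e3 - 5 * e2 * e3 - 5 * e1 * e4 +
        5 * e5 := by
    subst he1 he2 he3 he4 he5; ring
  obtain ⟨h5, h4, h3, h2, h1⟩ := coeffs_eq_zero_of_quintic e1 (u₄ - e2) (u₃ + e3) (u₂ - e4)
    (u₁ + e5) (u₀ - e6) fun t => by
      subst he1 he2 he3 he4 he5 he6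
      linear_combination h t
  rw [p1, p2, p3, p4, p5, h5, ← sub_eq_zero.1 h4, ← sub_eq_zero.1 h2,
    eq_neg_of_add_eq_zero_right h3, eq_neg_of_add_eq_zero_right h1]
  refine ⟨rfl, ?_, ?_, ?_, ?_⟩ <;> ring

set_option maxHeartbeats 4000000 in
/-- The Gram determinant of the trace form for the roots of the Satake sextic. -/
theorem det_trace_gram (a b c d e : ℂ) :
    (!![6, 0, -4*a, 0, 0, 20*(e*c);
        0, -4*a, -6*b, 0, 20*(e*c), 24*(e*d);
        -4*a, -6*b, 4*a^2, 20*(e*c), 24*(e*d), -36*(a*e*c);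
        0, 0, 20*(e*c), 24*(e*d), -16*(a*e*c), 4*e*(-6*(b*c)-4*(a*d));
        0, 20*(e*c), 24*(e*d), -16*(a*e*c), 4*e*(-6*(b*c)-4*(a*d)), 4*e*(4*(a^2*c)-6*(b*d));
        20*(e*c), 24*(e*d), -36*(a*e*c), 4*e*(-6*(b*c)-4*(a*d)), 4*e*(4*(a^2*c)-6*(b*d)),
          4*e*(c*(10*a*b+20*(e*c))+4*(a^2*d))]).det
     = 4096 * e^3 *
            (16*a^7*c^2*d - 16*a^6*b*c^3 + 16*a^5*c^4*e + 16*a^6*d^3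
              + 216*a^4*b^2*c^2*d + 888*a^4*c^2*d^2*e - 216*a^3*b^3*c^3
              - 3420*a^3*b*c^3*d*e + 2700*a^2*b^2*c^4*e + 4125*a^2*c^4*d*e^2
              - 5625*a*b*c^5*e^2 + 3125*c^6*e^3 + 216*a^3*b^2*d^3
              + 864*a^3*d^4*e - 2592*a^2*b*c*d^3*e + 729*a*b^4*c^2*d
              - 5670*a*b^2*c^2*d^2*e + 16200*a*c^2*d^3*e^2 - 729*b^5*c^3
              + 6075*b^3*c^3*d*e - 13500*b*c^3*d^2*e^2 + 729*b^4*d^3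
              - 5832*b^2*d^4*e + 11664*d^5*e^2) := by
  simp [Matrix.det_succ_row_zero, Fin.sum_univ_succ, Fin.succAbove]
  ring

/-- The discriminant of the Satake sextic
f(t) = (t³+at+b)² − 4e(ct+d), expressed as the product of squared root
differences, equals (up to a fixed nonzero rational constant) e³ times the
explicit polynomial in a,b,c,d,e. -/
theorem satake_sextic_discriminant :
    ∃ k : ℚ, k ≠ 0 ∧
      ∀ (a b c d e : ℂ) (x : Fin 6 → ℂ), e ≠ 0 →
        (∀ t : ℂ, (t^3 + a*t + b)^2 - 4*e*(c*t + d) = ∏ i, (t - x i)) →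
        (∏ i : Fin 6, ∏ j ∈ Finset.univ.filter (fun j => i < j), (x i - x j)^2)
          = (k : ℂ) * e^3 *
            (16*a^7*c^2*d - 16*a^6*b*c^3 + 16*a^5*c^4*e + 16*a^6*d^3
              + 216*a^4*b^2*c^2*d + 888*a^4*c^2*d^2*e - 216*a^3*b^3*c^3
              - 3420*a^3*b*c^3*d*e + 2700*a^2*b^2*c^4*e + 4125*a^2*c^4*d*e^2
              - 5625*a*b*c^5*e^2 + 3125*c^6*e^3 + 216*a^3*b^2*d^3
              + 864*a^3*d^4*e - 2592*a^2*b*c*d^3*e + 729*a*b^4*c^2*d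
              - 5670*a*b^2*c^2*d^2*e + 16200*a*c^2*d^3*e^2 - 729*b^5*c^3
              + 6075*b^3*c^3*d*e - 13500*b*c^3*d^2*e^2 + 729*b^4*d^3
              - 5832*b^2*d^4*e + 11664*d^5*e^2) := by
  refine ⟨4096, by norm_num, fun a b c d e x _ h => ?_⟩
  obtain ⟨p1, p2, p3, p4, p5⟩ := power_sums_of_sextic (2 * a) (2 * b) (a ^ 2)
    (2 * a * b - 4 * e * c) (b ^ 2 - 4 * e * d) x fun t => by rw [← h t]; ring
  have root : ∀ i, (x i ^ 3 + a * x i + b) ^ 2 = 4 * e * (c * x i + d) := fun i =>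
    sub_eq_zero.1 ((h (x i)).trans (Finset.prod_eq_zero (Finset.mem_univ i) (sub_self _)))
  have p0 : ∑ i : Fin 6, (1 : ℂ) = 6 := by simp
  let g : Fin 6 → ℂ := fun i => x i ^ 3 + a * x i + b
  have q0 : ∑ i, g i = 0 := by
    simp only [g, Finset.sum_add_distrib, ← Finset.mul_sum, p1, p3]
    simp
    ring
  have q1 : ∑ i, g i * x i = 0 := by
    calc ∑ i, g i * x i = ∑ i, (x i ^ 4 + a * x i ^ 2 + b * x i) :=
          Finset.sum_congr rfl fun i _ => by ring
      _ = 0 := by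
        simp only [Finset.sum_add_distrib, ← Finset.mul_sum, p1, p2, p4]
        ring
  have q2 : ∑ i, g i * x i ^ 2 = 20 * (e * c) := by
    calc ∑ i, g i * x i ^ 2 = ∑ i, (x i ^ 5 + a * x i ^ 3 + b * x i ^ 2) :=
          Finset.sum_congr rfl fun i _ => by ring
      _ = 20 * (e * c) := by
        simp only [Finset.sum_add_distrib, ← Finset.mul_sum, p2, p3, p5]
        ring
  have q3 : ∑ i, g i * x i ^ 3 = 24 * (e * d) := by
    calc ∑ i, g i * x i ^ 3
        = ∑ i, (4 * e * c * x i + 4 * e * d * 1 - a * (g i * x i) - b * g i) :=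
          Finset.sum_congr rfl fun i _ => by linear_combination root i
      _ = 24 * (e * d) := by
        simp only [Finset.sum_add_distrib, Finset.sum_sub_distrib, ← Finset.mul_sum, p0, p1, q0, q1]
        ring
  have q4 : ∑ i, g i * x i ^ 4 = -36 * (a * e * c) := by
    calc ∑ i, g i * x i ^ 4
        = ∑ i, (4 * e * c * x i ^ 2 + 4 * e * d * x i - a * (g i * x i ^ 2) - b * (g i * x i)) :=
          Finset.sum_congr rfl fun i _ => by linear_combination x i * root i
      _ = -36 * (a * e * c) := by
        simp only [Finset.sum_add_distrib, Finset.sum_sub_distrib, ← Finset.mul_sum, p1, p2, q1, q2]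
        ring
  have w (m : ℕ) : ∑ i, g i ^ 2 * x i ^ m =
      4 * e * (c * ∑ i, x i ^ (m + 1) + d * ∑ i, x i ^ m) := by
    simp only [Finset.mul_sum, ← Finset.sum_add_distrib]
    exact Finset.sum_congr rfl fun i _ => by rw [root i]; ring
  have w0 : ∑ i, g i ^ 2 = 24 * (e * d) := by
    have := w 0
    simp only [pow_zero, zero_add, pow_one, mul_one, p0, p1] at this
    rw [this]; ring
  have w1 := w 1
  have w2 := w 2
  have w3 := w 3
  have w4 := w 4
  simp only [pow_one, Nat.reduceAdd, p1, p2, p3, p4, p5] at w1 w2 w3 w4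
  rw [prod_sq_sub_eq_det_gram a b, Rat.cast_ofNat, ← det_trace_gram]
  congr 1
  ext j k
  change ∑ i, ![1, x i, x i ^ 2, g i, g i * x i, g i * x i ^ 2] j *
    ![1, x i, x i ^ 2, g i, g i * x i, g i * x i ^ 2] k = _
  fin_cases j <;> fin_cases k <;> simp <;> ring_nf <;>
    simp only [mul_comm (x _ ^ _) (g _), mul_comm (x _) (g _), p1, p2, p3, p4, q0, q1, q2, q3, q4,
      w0, w1, w2, w3, w4] <;> ring
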